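/- Let ℬ be a simply rooted family in 𝒫(n) with |ℬ| = m, and let p ∈ [0,1]. Suppose that |ℬ_{{i}}| ≤ p·m for all i ∈ [n]. Then ‖ℬ‖ ≤ ‖I(m)‖ + m − m²(1/12 − p²/12)/2^n. -/

import Mathlib

open Finset
open scoped Classical

/-- The total size `‖𝒜‖ = Σ_{A∈𝒜} |A|` of a family of finite sets. -/
def totalSize (𝒜 : Finset (Finset ℕ)) : ℕ := ∑ A ∈ 𝒜, A.card

/-- A family is union-closed if it is closed under pairwise unions. -/
def UnionClosed (𝒜 : Finset (Finset ℕ)) : Prop := ∀ A ∈ 𝒜, ∀ B ∈ 𝒜, A ∪ B ∈ 𝒜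

/-- The `k`-th finite set of positive integers in the colex order: the positive
integer `i` belongs to it iff bit `i - 1` of `k` is set. -/
def colexSet (k : ℕ) : Finset ℕ :=
  ((Finset.range (k + 1)).filter fun i => k.testBit i).image (· + 1)

/-- The initial segment `I(m)` of length `m` of the colex order on finite sets
of positive integers. -/
def colexInit (m : ℕ) : Finset (Finset ℕ) := (Finset.range m).image colexSet

/-- A family `ℬ` is simply rooted if every nonempty `B ∈ ℬ` has some `b ∈ B`
with the whole cube `[{b}, B]` contained in `ℬ`. -/
def SimplyRooted (ℬ : Finset (Finset ℕ)) : Prop :=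
  ∀ B ∈ ℬ, B.Nonempty → ∃ b ∈ B, ∀ C : Finset ℕ, {b} ⊆ C → C ⊆ B → C ∈ ℬ

/-- `B` is `ℬ`-rooted at `i`: `i ∈ B` and the cube `[{i}, B]` lies in `ℬ`. -/
def RootedAt (ℬ : Finset (Finset ℕ)) (B : Finset ℕ) (i : ℕ) : Prop :=
  i ∈ B ∧ ∀ C : Finset ℕ, {i} ⊆ C → C ⊆ B → C ∈ ℬ

/-- `ℬ_S`: the sets of `ℬ` that are `ℬ`-rooted at some element of `S`. -/
noncomputable def rootedFam (ℬ : Finset (Finset ℕ)) (S : Finset ℕ) : Finset (Finset ℕ) :=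
  ℬ.filter fun B => ∃ i ∈ S, RootedAt ℬ B i

/-- The image of a single set `B` under the down-compression of `ℬ` in
direction `i`. -/
def compressSet (ℬ : Finset (Finset ℕ)) (i : ℕ) (B : Finset ℕ) : Finset ℕ :=
  if i ∈ B ∧ B.erase i ∉ ℬ then B.erase i else B

/-- The down-compression `d_i(ℬ)` of the family `ℬ` in direction `i`. -/
def dComp (i : ℕ) (ℬ : Finset (Finset ℕ)) : Finset (Finset ℕ) :=
  ℬ.image (compressSet ℬ i)

/-- `D_k(ℬ) = d_k(⋯ d_1(ℬ) ⋯)`.  In particular `d(ℬ) = D_n(ℬ)` for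
`ℬ ⊆ 𝒫(n)`. -/
def DComp : ℕ → Finset (Finset ℕ) → Finset (Finset ℕ)
  | 0, ℬ => ℬ
  | k + 1, ℬ => dComp (k + 1) (DComp k ℬ)

/-- `D_{(ℬ,k)}(B)`: the image of the set `B` obtained by following `B` through
the successive compressions `d_1, …, d_k`.  In particular `d_ℬ(B) = D_{(ℬ,n)}(B)`
for `ℬ ⊆ 𝒫(n)`. -/
def DCompSet : ℕ → Finset (Finset ℕ) → Finset ℕ → Finset ℕ
  | 0, _, B => B
  | k + 1, ℬ, B => compressSet (DComp k ℬ) (k + 1) (DCompSet k ℬ B)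

/-- The shadow `δB = {B \ {i} : i ∈ B}` of a finite set `B`. -/
def shadowSet (B : Finset ℕ) : Finset (Finset ℕ) := B.image fun i => B.erase i

/-- `B` is a bad set of `ℬ ⊆ 𝒫(n)` if `δB ⊆ ℬ` or `d_ℬ(B) = B`. -/
def BadSet (n : ℕ) (ℬ : Finset (Finset ℕ)) (B : Finset ℕ) : Prop :=
  shadowSet B ⊆ ℬ ∨ DCompSet n ℬ B = B

/-- A family is a down-set if it is closed under taking subsets. -/
def IsDownSet (𝒟 : Finset (Finset ℕ)) : Prop := ∀ A ∈ 𝒟, ∀ B ⊆ A, B ∈ 𝒟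

/-- The deficiency `def(ℬ) = Σ_{B∈ℬ} |δB \ ℬ|`. -/
def deficiency (ℬ : Finset (Finset ℕ)) : ℕ := ∑ B ∈ ℬ, (shadowSet B \ ℬ).card

/-- `𝒜 ⊆ 𝒫(n)` is a counterexample to the union-closed conjecture:
union-closed, not `{∅}`, and every element of `[n]` has degree `< |𝒜|/2`. -/
def UCCounterexample (n : ℕ) (𝒜 : Finset (Finset ℕ)) : Prop :=
  𝒜 ⊆ (Finset.Icc 1 n).powerset ∧ UnionClosed 𝒜 ∧ 𝒜 ≠ {∅} ∧
    ∀ i ∈ Finset.Icc 1 n, ((𝒜.filter fun A => i ∈ A).card : ℚ) < (𝒜.card : ℚ) / 2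

open scoped FinsetFamily

/-- The number of pairs `(B, B \ {i})` of members of `𝒜` with `i ∈ B`. -/
def edgeCount (𝒜 : Finset (Finset ℕ)) : ℕ := ∑ B ∈ 𝒜, #{i ∈ B | B.erase i ∈ 𝒜}

/-- The sum of the sizes of the first `m` sets in the colex order. -/
def colexSum (m : ℕ) : ℕ := ∑ k ∈ range m, #(colexSet k)

lemma mem_colexSet {k x : ℕ} : x ∈ colexSet k ↔ ∃ i, k.testBit i = true ∧ i + 1 = x := by
  unfold colexSet
  simp only [mem_image, mem_filter, mem_range]
  constructor
  · rintro ⟨i, ⟨_, h⟩, rfl⟩; exact ⟨i, h, rfl⟩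
  · rintro ⟨i, h, rfl⟩
    have := Nat.ge_two_pow_of_testBit h
    have := @Nat.lt_two_pow_self i
    exact ⟨i, ⟨by omega, h⟩, rfl⟩

lemma colexSet_injective : Function.Injective colexSet := by
  intro k l h
  apply Nat.eq_of_testBit_eq
  intro i
  have := congrArg (i + 1 ∈ ·) h
  simp only [mem_colexSet, add_left_inj, exists_eq_right, eq_iff_iff] at this
  exact Bool.eq_iff_iff.2 this

lemma totalSize_colexInit (m : ℕ) : totalSize (colexInit m) = colexSum m :=
  sum_image colexSet_injective.injOn

lemma colexSet_two_mul (k : ℕ) : colexSet (2 * k) = (colexSet k).image (· + 1) := by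
  ext x
  simp only [mem_image, mem_colexSet]
  constructor
  · rintro ⟨i, h, rfl⟩
    cases i with
    | zero => simp at h
    | succ i =>
      rw [Nat.testBit_succ] at h
      exact ⟨i + 1, ⟨i, by simpa using h, rfl⟩, rfl⟩
  · rintro ⟨_, ⟨i, h, rfl⟩, rfl⟩
    exact ⟨i + 1, by rw [Nat.testBit_succ]; simpa using h, rfl⟩

lemma colexSet_two_mul_add_one (k : ℕ) :
    colexSet (2 * k + 1) = insert 1 ((colexSet k).image (· + 1)) := by
  ext x
  simp only [mem_insert, mem_image, mem_colexSet]
  have hk : (2 * k + 1) / 2 = k := by omega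
  constructor
  · rintro ⟨i, h, rfl⟩
    cases i with
    | zero => simp
    | succ i =>
      rw [Nat.testBit_succ, hk] at h
      exact Or.inr ⟨i + 1, ⟨i, h, rfl⟩, rfl⟩
  · rintro (rfl | ⟨_, ⟨i, h, rfl⟩, rfl⟩)
    · exact ⟨0, by simp, rfl⟩
    · exact ⟨i + 1, by rwa [Nat.testBit_succ, hk], rfl⟩

lemma card_colexSet_two_mul (k : ℕ) : #(colexSet (2 * k)) = #(colexSet k) := by
  rw [colexSet_two_mul, card_image_of_injective _ (add_left_injective 1)]

lemma card_colexSet_two_mul_add_one (k : ℕ) :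
    #(colexSet (2 * k + 1)) = #(colexSet k) + 1 := by
  rw [colexSet_two_mul_add_one, card_insert_of_notMem,
    card_image_of_injective _ (add_left_injective 1)]
  simp [mem_colexSet]

lemma colexSum_succ (m : ℕ) : colexSum (m + 1) = colexSum m + #(colexSet m) :=
  sum_range_succ _ _

lemma colexSum_two_mul (k : ℕ) : colexSum (2 * k) = 2 * colexSum k + k := by
  induction k with
  | zero => rfl
  | succ k ih =>
    rw [show 2 * (k + 1) = 2 * k + 1 + 1 by ring, colexSum_succ, colexSum_succ, ih,
      card_colexSet_two_mul, card_colexSet_two_mul_add_one, colexSum_succ]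
    ring

lemma colexSum_two_mul_add_one (k : ℕ) :
    colexSum (2 * k + 1) = colexSum k + colexSum (k + 1) + k := by
  rw [colexSum_succ, colexSum_two_mul, colexSum_succ, card_colexSet_two_mul]
  ring

lemma colexSum_add_colexSum_add_min_le (a b : ℕ) :
    colexSum a + colexSum b + min a b ≤ colexSum (a + b) := by
  induction h : a + b using Nat.strong_induction_on generalizing a b with
  | _ N ih =>
    subst h
    rcases Nat.eq_zero_or_pos a with rfl | ha
    · simp [colexSum]
    rcases Nat.eq_zero_or_pos b with rfl | hb
    · simp [colexSum]
    rcases Nat.even_or_odd' a with ⟨c, rfl | rfl⟩ <;> rcases Nat.even_or_odd' b with ⟨d, rfl | rfl⟩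
    · have := ih (c + d) (by omega) c d rfl
      rw [← mul_add]
      simp only [colexSum_two_mul]
      omega
    · have h₁ := ih (c + d) (by omega) c d rfl
      have h₂ := ih (c + (d + 1)) (by omega) c (d + 1) rfl
      rw [show 2 * c + (2 * d + 1) = 2 * (c + d) + 1 by ring]
      simp only [colexSum_two_mul, colexSum_two_mul_add_one]
      rw [← add_assoc] at h₂
      omega
    · have h₁ := ih (c + d) (by omega) c d rfl
      have h₂ := ih (c + 1 + d) (by omega) (c + 1) d rfl
      rw [show 2 * c + 1 + 2 * d = 2 * (c + d) + 1 by ring]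
      simp only [colexSum_two_mul, colexSum_two_mul_add_one]
      rw [show c + 1 + d = c + d + 1 by ring] at h₂
      omega
    · have h₁ := ih (c + (d + 1)) (by omega) c (d + 1) rfl
      have h₂ := ih (c + 1 + d) (by omega) (c + 1) d rfl
      rw [show 2 * c + 1 + (2 * d + 1) = 2 * (c + d + 1) by ring]
      simp only [colexSum_two_mul, colexSum_two_mul_add_one]
      rw [show c + 1 + d = c + d + 1 by ring] at h₂
      rw [← add_assoc] at h₁
      omega

lemma edgeCount_eq_subfamilies (a : ℕ) (𝒜 : Finset (Finset ℕ)) :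
    edgeCount 𝒜 = edgeCount (𝒜.nonMemberSubfamily a) + edgeCount (𝒜.memberSubfamily a)
      + #(𝒜.nonMemberSubfamily a ∩ 𝒜.memberSubfamily a) := by
  have h₀ : ∑ B ∈ 𝒜 with a ∉ B, #{i ∈ B | B.erase i ∈ 𝒜} =
      edgeCount (𝒜.nonMemberSubfamily a) := by
    unfold edgeCount
    refine sum_congr rfl fun B hB => ?_
    congr 1
    ext i
    have := (mem_filter.1 hB).2
    simp [mem_nonMemberSubfamily, this]
  have h₁ : ∑ B ∈ 𝒜 with a ∈ B, #{i ∈ B | B.erase i ∈ 𝒜} =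
      ∑ C ∈ 𝒜.memberSubfamily a,
        (#{i ∈ C | C.erase i ∈ 𝒜.memberSubfamily a} + if C ∈ 𝒜 then 1 else 0) := by
    refine sum_bij' (fun B _ => B.erase a) (fun C _ => insert a C) ?_ ?_ ?_ ?_ ?_
    · intro B hB
      obtain ⟨hB, ha⟩ := mem_filter.1 hB
      simp [mem_memberSubfamily, insert_erase ha, hB]
    · intro C hC
      simpa using (mem_memberSubfamily.1 hC).1
    · intro B hB
      exact insert_erase (mem_filter.1 hB).2
    · intro C hC
      exact erase_insert (mem_memberSubfamily.1 hC).2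
    · intro B hB
      obtain ⟨hB, ha⟩ := mem_filter.1 hB
      have hins : ∀ i ∈ B.erase a, insert a ((B.erase a).erase i) = B.erase i := by
        intro i hi
        grind
      have : {i ∈ B.erase a | (B.erase a).erase i ∈ 𝒜.memberSubfamily a} =
          {i ∈ B.erase a | B.erase i ∈ 𝒜} := by
        refine filter_congr fun i hi => ?_
        rw [mem_memberSubfamily, hins i hi]
        simp
      have hB' := congrArg (filter fun i => B.erase i ∈ 𝒜) (insert_erase ha)
      rw [filter_insert] at hB'
      rw [this, ← hB']
      split_ifs with h
      · rw [card_insert_of_notMem (by simp)]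
      · rfl
  have h₂ : #(𝒜.nonMemberSubfamily a ∩ 𝒜.memberSubfamily a) =
      ∑ C ∈ 𝒜.memberSubfamily a, if C ∈ 𝒜 then 1 else 0 := by
    rw [← card_filter]
    congr 1
    ext C
    simp only [mem_inter, mem_nonMemberSubfamily, mem_memberSubfamily, mem_filter]
    tauto
  rw [h₂, add_assoc]
  unfold edgeCount at h₀ ⊢
  rw [← sum_add_distrib, ← h₁, ← h₀, add_comm]
  exact (sum_filter_add_sum_filter_not _ _ _).symm

lemma edgeCount_le_colexSum_of_subset (U : Finset ℕ) (𝒜 : Finset (Finset ℕ))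
    (h : ∀ A ∈ 𝒜, A ⊆ U) : edgeCount 𝒜 ≤ colexSum #𝒜 := by
  induction U using Finset.induction_on generalizing 𝒜 with
  | empty =>
    have : edgeCount 𝒜 = 0 := sum_eq_zero fun B hB => by simp [subset_empty.1 (h B hB)]
    omega
  | insert a U _ ih =>
    have h₀ := ih (𝒜.nonMemberSubfamily a) fun A hA => by
      rw [mem_nonMemberSubfamily] at hA
      exact (subset_insert_iff_of_notMem hA.2).1 (h A hA.1)
    have h₁ := ih (𝒜.memberSubfamily a) fun A hA => by
      rw [mem_memberSubfamily] at hA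
      exact (subset_insert_iff_of_notMem hA.2).1 ((subset_insert a A).trans (h _ hA.1))
    have h₂ := colexSum_add_colexSum_add_min_le #(𝒜.nonMemberSubfamily a) #(𝒜.memberSubfamily a)
    have h₃ := card_le_card
      (inter_subset_left : 𝒜.nonMemberSubfamily a ∩ 𝒜.memberSubfamily a ⊆ _)
    have h₄ := card_le_card
      (inter_subset_right : 𝒜.nonMemberSubfamily a ∩ 𝒜.memberSubfamily a ⊆ _)
    have h₅ := card_memberSubfamily_add_card_nonMemberSubfamily a 𝒜
    rw [edgeCount_eq_subfamilies a, ← h₅, add_comm #(𝒜.memberSubfamily a)]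
    omega

/-- The edge-isoperimetric inequality in the discrete cube. -/
lemma edgeCount_le_colexSum (𝒜 : Finset (Finset ℕ)) : edgeCount 𝒜 ≤ colexSum #𝒜 :=
  edgeCount_le_colexSum_of_subset (𝒜.sup id) 𝒜 fun _ hA => le_sup (f := id) hA

lemma totalSize_eq_edgeCount {𝒜 : Finset (Finset ℕ)} (h : IsDownSet 𝒜) :
    totalSize 𝒜 = edgeCount 𝒜 :=
  sum_congr rfl fun B hB => by
    rw [filter_true_of_mem fun i _ => h B hB _ (erase_subset i B)]

lemma rootedAt_iff {ℬ : Finset (Finset ℕ)} {B : Finset ℕ} {i : ℕ} :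
    RootedAt ℬ B i ↔ i ∈ B ∧ ∀ C ⊆ B, i ∈ C → C ∈ ℬ := by
  simp only [RootedAt, singleton_subset_iff]
  exact and_congr_right fun _ => forall_congr' fun _ => forall_comm

lemma SimplyRooted.exists_rootedAt {ℬ : Finset (Finset ℕ)} (h : SimplyRooted ℬ) {B : Finset ℕ}
    (hB : B ∈ ℬ) (hne : B.Nonempty) : ∃ b, RootedAt ℬ B b := by
  obtain ⟨b, hb, h⟩ := h B hB hne
  exact ⟨b, hb, h⟩

lemma RootedAt.mem {ℬ : Finset (Finset ℕ)} {B C : Finset ℕ} {i : ℕ} (h : RootedAt ℬ B i)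
    (hCB : C ⊆ B) (hi : i ∈ C) : C ∈ ℬ :=
  (rootedAt_iff.1 h).2 C hCB hi

lemma RootedAt.erase_mem {ℬ : Finset (Finset ℕ)} {B : Finset ℕ} {i j : ℕ} (h : RootedAt ℬ B i)
    (hij : i ≠ j) : B.erase j ∈ ℬ :=
  h.mem (erase_subset j B) (mem_erase.2 ⟨hij, h.1⟩)

lemma SimplyRooted.rootedAt_of_not_subset {ℬ : Finset (Finset ℕ)} (h : SimplyRooted ℬ)
    {B W : Finset ℕ} {i : ℕ} (hB : B ∈ ℬ) (hW : W ∉ ℬ) (hWB : W ⊆ B) (hi : i ∈ B)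
    (hBW : ∀ j ∈ B, j ≠ i → j ∈ W) : RootedAt ℬ B i := by
  obtain ⟨b, hb⟩ := h.exists_rootedAt hB ⟨i, hi⟩
  by_cases hbi : b = i
  · exact hbi ▸ hb
  · exact absurd (hb.mem hWB (hBW b hb.1 hbi)) hW

lemma SimplyRooted.rootedAt_of_erase_notMem {ℬ : Finset (Finset ℕ)} (h : SimplyRooted ℬ)
    {B : Finset ℕ} {i : ℕ} (hB : B ∈ ℬ) (hBi : B.erase i ∉ ℬ) : RootedAt ℬ B i := by
  have hi : i ∈ B := by
    by_contra hi
    exact hBi (by rwa [erase_eq_of_notMem hi])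
  exact h.rootedAt_of_not_subset hB hBi (erase_subset i B) hi fun j hj hji =>
    mem_erase.2 ⟨hji, hj⟩

lemma mem_compression_of_erase_mem {R : Finset (Finset ℕ)} {C : Finset ℕ} {i : ℕ} (hC : C ∈ R)
    (hCi : C.erase i ∈ R) : C ∈ 𝓓 i R :=
  Down.mem_compression.2 (Or.inl ⟨hC, hCi⟩)

lemma mem_compression_of_notMem {R : Finset (Finset ℕ)} {C : Finset ℕ} {i : ℕ} (hC : C ∈ R)
    (hi : i ∉ C) : C ∈ 𝓓 i R :=
  mem_compression_of_erase_mem hC (by rwa [erase_eq_of_notMem hi])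

lemma mem_of_mem_compression {R : Finset (Finset ℕ)} {C : Finset ℕ} {i : ℕ} (hC : C ∈ 𝓓 i R)
    (hi : i ∈ C) : C ∈ R ∧ C.erase i ∈ R := by
  rcases Down.mem_compression.1 hC with h | ⟨h, h'⟩
  · exact h
  · rw [insert_eq_of_mem hi] at h'
    exact absurd h' h

lemma RootedAt.mem_compression_self {R : Finset (Finset ℕ)} {B X : Finset ℕ} {i : ℕ}
    (h : RootedAt R B i) (hX : X ⊆ B.erase i) : X ∈ 𝓓 i R := by
  have hiX : i ∉ X := fun hi => notMem_erase i B (hX hi)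
  by_cases hXR : X ∈ R
  · exact mem_compression_of_notMem hXR hiX
  · exact Down.mem_compression.2 (Or.inr ⟨hXR, h.mem
      (insert_subset h.1 (hX.trans (erase_subset i B))) (mem_insert_self i X)⟩)

lemma RootedAt.compression {R : Finset (Finset ℕ)} {B : Finset ℕ} {i j : ℕ}
    (h : RootedAt R B j) (hij : i ≠ j) : RootedAt (𝓓 i R) B j :=
  rootedAt_iff.2 ⟨h.1, fun _ hX hj => mem_compression_of_erase_mem (h.mem hX hj)
    (h.mem ((erase_subset i _).trans hX) (mem_erase.2 ⟨hij.symm, hj⟩))⟩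

lemma mem_compression_of_forall_subset {R : Finset (Finset ℕ)} {B : Finset ℕ} (i : ℕ)
    (h : ∀ X ⊆ B, X ∈ R) : ∀ X ⊆ B, X ∈ 𝓓 i R := fun X hX =>
  mem_compression_of_erase_mem (h X hX) (h _ ((erase_subset i X).trans hX))

lemma rootedAt_of_forall_subset {R : Finset (Finset ℕ)} {B : Finset ℕ} {i : ℕ} (hi : i ∈ B)
    (h : ∀ X ⊆ B, X ∈ R) : RootedAt R B i :=
  rootedAt_iff.2 ⟨hi, fun X hX _ => h X hX⟩

lemma SimplyRooted.compression {R : Finset (Finset ℕ)} (h : SimplyRooted R) (i : ℕ) :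
    SimplyRooted (𝓓 i R) := by
  suffices ∀ C ∈ 𝓓 i R, C.Nonempty → ∃ b, RootedAt (𝓓 i R) C b by
    intro C hC hne
    obtain ⟨b, hb⟩ := this C hC hne
    exact ⟨b, hb.1, hb.2⟩
  intro C hC hne
  by_cases hi : i ∈ C
  · obtain ⟨hCR, hCi⟩ := mem_of_mem_compression hC hi
    obtain ⟨c, hc⟩ := h.exists_rootedAt hCR hne
    by_cases hic : i = c
    · subst hic
      by_cases hne' : (C.erase i).Nonempty
      · obtain ⟨b, hb⟩ := h.exists_rootedAt hCi hne'
        have hbi := mem_erase.1 hb.1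
        refine ⟨b, rootedAt_iff.2 ⟨hbi.2, fun X hX hbX => ?_⟩⟩
        by_cases hiX : i ∈ X
        · exact mem_compression_of_erase_mem (hc.mem hX hiX)
            (hb.mem (erase_subset_erase i hX) (mem_erase.2 ⟨hbi.1, hbX⟩))
        · exact hc.mem_compression_self (subset_erase.2 ⟨hX, hiX⟩)
      · refine ⟨i, rootedAt_iff.2 ⟨hi, fun X hX hiX => ?_⟩⟩
        rw [not_nonempty_iff_eq_empty] at hne'
        have : X.erase i = C.erase i := by
          rw [hne', ← subset_empty, ← hne']
          exact erase_subset_erase i hX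
        exact mem_compression_of_erase_mem (hc.mem hX hiX) (this ▸ hCi)
    · exact ⟨c, hc.compression hic⟩
  · rcases Down.mem_compression.1 hC with ⟨hCR, -⟩ | ⟨hCR, hCi⟩
    · obtain ⟨b, hb⟩ := h.exists_rootedAt hCR hne
      exact ⟨b, hb.compression fun hib => hi (hib ▸ hb.1)⟩
    · obtain ⟨b, hb⟩ := hne
      have := h.rootedAt_of_erase_notMem hCi (by rwa [erase_insert hi])
      exact ⟨b, rootedAt_of_forall_subset hb fun X hX =>
        this.mem_compression_self (by rwa [erase_insert hi])⟩

/-- Rootedness at `j` can be traced back through a compression as long as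
some subset avoiding `j` is missing. -/
lemma SimplyRooted.rootedAt_of_compression {R : Finset (Finset ℕ)} (h : SimplyRooted R)
    {B W : Finset ℕ} {i j : ℕ} (hB : RootedAt (𝓓 i R) B j) (hWB : W ⊆ B.erase j)
    (hW : W ∉ 𝓓 i R) : RootedAt R B j ∧ ∃ V ⊆ B.erase j, V ∉ R := by
  by_cases hi : i ∈ B
  · constructor
    · refine rootedAt_iff.2 ⟨hB.1, fun X hX hj => ?_⟩
      have hins := hB.mem (insert_subset hi hX) (mem_insert_of_mem hj)
      by_cases hiX : i ∈ X
      · rw [insert_eq_of_mem hiX] at hins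
        exact (mem_of_mem_compression hins hiX).1
      · simpa [hiX] using (mem_of_mem_compression hins (mem_insert_self i X)).2
    · by_contra! hV
      exact hW (mem_compression_of_forall_subset i hV W hWB)
  · have hiW : i ∉ W := fun hiW => hi (mem_of_mem_erase (hWB hiW))
    have hWR : W ∉ R := fun hWR => hW (mem_compression_of_notMem hWR hiW)
    have hWi : insert i W ∉ R := fun hWi => hW (Down.mem_compression.2 (Or.inr ⟨hWR, hWi⟩))
    refine ⟨rootedAt_iff.2 ⟨hB.1, fun X hX hj => ?_⟩, W, hWB, hWR⟩
    have hXW : X ∪ W ⊆ B := union_subset hX (hWB.trans (erase_subset j B))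
    have hiXW : i ∉ X ∪ W := fun hmem => hi (hXW hmem)
    have hXWR : X ∪ W ∈ R := by
      rcases Down.mem_compression.1 (hB.mem hXW (mem_union_left W hj)) with hR | ⟨hR, hR'⟩
      · exact hR.1
      · have := h.rootedAt_of_erase_notMem hR' (by rwa [erase_insert hiXW])
        exact absurd (this.mem (insert_subset_insert i subset_union_right)
          (mem_insert_self i W)) hWi
    obtain ⟨c, hc⟩ := h.exists_rootedAt hXWR ⟨j, mem_union_left W hj⟩
    rcases mem_union.1 hc.1 with hcX | hcW
    · exact hc.mem subset_union_left hcX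
    · exact absurd (hc.mem subset_union_right hcW) hWR

/-- The successive down-compressions in directions `1, …, k`. -/
def compressUpTo : ℕ → Finset (Finset ℕ) → Finset (Finset ℕ)
  | 0, R => R
  | k + 1, R => 𝓓 (k + 1) (compressUpTo k R)

lemma card_compressUpTo (k : ℕ) (R : Finset (Finset ℕ)) : #(compressUpTo k R) = #R := by
  induction k with
  | zero => rfl
  | succ k ih => exact (Down.card_compression _ _).trans ih

lemma SimplyRooted.simplyRooted_compressUpTo {R : Finset (Finset ℕ)} (h : SimplyRooted R) (k : ℕ) :
    SimplyRooted (compressUpTo k R) := by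
  induction k with
  | zero => exact h
  | succ k ih => exact ih.compression _

lemma subset_of_mem_compressUpTo {R : Finset (Finset ℕ)} {U : Finset ℕ} (h : ∀ A ∈ R, A ⊆ U)
    (k : ℕ) : ∀ A ∈ compressUpTo k R, A ⊆ U := by
  induction k with
  | zero => exact h
  | succ k ih =>
    intro A hA
    rcases Down.mem_compression.1 hA with h' | h'
    · exact ih A h'.1
    · exact (subset_insert _ A).trans (ih _ h'.2)

lemma erase_mem_compression_of_forall {R : Finset (Finset ℕ)} {i : ℕ}
    (h : ∀ C ∈ R, C.erase i ∈ R) (j : ℕ) : ∀ C ∈ 𝓓 j R, C.erase i ∈ 𝓓 j R := by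
  intro C hC
  by_cases hij : i = j
  · exact hij ▸ Down.erase_mem_compression_of_mem_compression (hij ▸ hC)
  rcases Down.mem_compression.1 hC with ⟨h₁, h₂⟩ | ⟨h₁, h₂⟩
  · exact mem_compression_of_erase_mem (h C h₁) (by rw [erase_right_comm]; exact h _ h₂)
  · have hj : j ∉ C := fun hj => h₁ (by rwa [insert_eq_of_mem hj] at h₂)
    have hins : insert j (C.erase i) ∈ R := by
      rw [← erase_insert_of_ne (Ne.symm hij)]
      exact h _ h₂
    by_cases hCi : C.erase i ∈ R
    · exact mem_compression_of_notMem hCi fun hj' => hj (mem_of_mem_erase hj')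
    · exact Down.mem_compression.2 (Or.inr ⟨hCi, hins⟩)

lemma erase_mem_compressUpTo {R : Finset (Finset ℕ)} {i k : ℕ} (hi : 1 ≤ i) (hik : i ≤ k) :
    ∀ C ∈ compressUpTo k R, C.erase i ∈ compressUpTo k R := by
  induction k, hik using Nat.le_induction with
  | base =>
    obtain ⟨i, rfl⟩ := Nat.exists_eq_add_of_le' hi
    exact fun C hC => Down.erase_mem_compression_of_mem_compression hC
  | succ k _ ih => exact erase_mem_compression_of_forall ih _

lemma isDownSet_of_erase_mem {R : Finset (Finset ℕ)} {U : Finset ℕ} (hU : ∀ A ∈ R, A ⊆ U)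
    (h : ∀ i ∈ U, ∀ C ∈ R, C.erase i ∈ R) : IsDownSet R := by
  have key : ∀ (T A : Finset ℕ), A ∈ R → T ⊆ U → A \ T ∈ R := by
    intro T
    induction T using Finset.induction_on with
    | empty => simp
    | insert a T _ ih =>
      intro A hA hT
      rw [sdiff_insert]
      exact h a (hT (mem_insert_self a T)) _ (ih A hA ((subset_insert a T).trans hT))
  intro A hA B hBA
  rw [← Finset.sdiff_sdiff_eq_self hBA]
  exact key _ A hA (sdiff_subset.trans (hU A hA))

lemma isDownSet_compressUpTo {R : Finset (Finset ℕ)} {n : ℕ} (hR : ∀ A ∈ R, A ⊆ Icc 1 n) :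
    IsDownSet (compressUpTo n R) :=
  isDownSet_of_erase_mem (subset_of_mem_compressUpTo hR n) fun _ hi =>
    erase_mem_compressUpTo (mem_Icc.1 hi).1 (mem_Icc.1 hi).2

lemma RootedAt.rootedAt_compressUpTo {R : Finset (Finset ℕ)} {B : Finset ℕ} {j k : ℕ}
    (h : RootedAt R B j) (hk : k < j) : RootedAt (compressUpTo k R) B j := by
  induction k with
  | zero => exact h
  | succ k ih => exact (ih (by omega)).compression (by omega)

lemma RootedAt.mem_compressUpTo {R : Finset (Finset ℕ)} {B : Finset ℕ} {j n : ℕ}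
    (h : RootedAt R B j) (hj : 1 ≤ j) (hjn : j ≤ n) :
    ∀ X ⊆ B.erase j, X ∈ compressUpTo n R := by
  induction n, hjn using Nat.le_induction with
  | base =>
    obtain ⟨j, rfl⟩ := Nat.exists_eq_add_of_le' hj
    exact fun X hX => (h.rootedAt_compressUpTo (Nat.lt_succ_self j)).mem_compression_self hX
  | succ n _ ih => exact mem_compression_of_forall_subset _ ih

lemma SimplyRooted.rootedAt_of_compressUpTo {R : Finset (Finset ℕ)} (h : SimplyRooted R)
    {B W : Finset ℕ} {j k : ℕ} (hk : k < j) (hB : RootedAt (compressUpTo k R) B j)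
    (hWB : W ⊆ B.erase j) (hW : W ∉ compressUpTo k R) : RootedAt R B j := by
  induction k generalizing W with
  | zero => exact hB
  | succ k ih =>
    obtain ⟨hB', V, hVB, hV⟩ :=
      (h.simplyRooted_compressUpTo k).rootedAt_of_compression hB hWB hW
    exact ih (by omega) hB' hVB hV

lemma totalSize_le_totalSize_compression (i : ℕ) (R : Finset (Finset ℕ)) :
    totalSize R ≤ totalSize (𝓓 i R) + #{B ∈ R | B.erase i ∉ R} := by
  have hinj : Set.InjOn (fun B : Finset ℕ => B.erase i) ({B ∈ R | B.erase i ∉ R} : Finset _) := by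
    refine (erase_injOn' i).mono fun B hB => ?_
    obtain ⟨hB, hBi⟩ := mem_filter.1 (mem_coe.1 hB)
    by_contra hi
    exact hBi (by rwa [erase_eq_of_notMem hi])
  have hdisj : Disjoint {B ∈ R | B.erase i ∈ R}
      ({B ∈ R | B.erase i ∉ R}.image fun B => B.erase i) := by
    rw [disjoint_left]
    intro B hB hB'
    obtain ⟨C, hC, rfl⟩ := mem_image.1 hB'
    exact (mem_filter.1 hC).2 (mem_filter.1 hB).1
  have hsub : {B ∈ R | B.erase i ∈ R} ∪ ({B ∈ R | B.erase i ∉ R}.image fun B => B.erase i) ⊆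
      𝓓 i R := by
    intro B hB
    rcases mem_union.1 hB with hB | hB
    · obtain ⟨hB, hBi⟩ := mem_filter.1 hB
      exact mem_compression_of_erase_mem hB hBi
    · obtain ⟨C, hC, rfl⟩ := mem_image.1 hB
      exact Down.erase_mem_compression (mem_filter.1 hC).1
  calc totalSize R = ∑ B ∈ R with B.erase i ∈ R, #B + ∑ B ∈ R with B.erase i ∉ R, #B :=
        (sum_filter_add_sum_filter_not _ _ _).symm
    _ ≤ ∑ B ∈ R with B.erase i ∈ R, #B + ∑ B ∈ R with B.erase i ∉ R, (#(B.erase i) + 1) := by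
        gcongr with B
        exact Nat.sub_le_iff_le_add.1 pred_card_le_card_erase
    _ ≤ _ := by
        rw [sum_add_distrib, ← card_eq_sum_ones, ← add_assoc,
          ← sum_image (f := fun B => #B) hinj, ← sum_union hdisj]
        exact Nat.add_le_add_right (sum_le_sum_of_subset hsub) _

lemma SimplyRooted.exists_totalSize_le {ℬ F : Finset (Finset ℕ)} (h : SimplyRooted ℬ) {n k : ℕ}
    (hF : ∀ B j, 1 ≤ j → j ≤ n → RootedAt ℬ B j → B.erase j ∈ F) (hk : k ≤ n) :
    ∃ M ⊆ F, (∀ C ∈ M, ∀ X ⊆ C, X ∈ compressUpTo k ℬ) ∧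
      totalSize ℬ ≤ totalSize (compressUpTo k ℬ) + #M := by
  induction k with
  | zero => exact ⟨∅, empty_subset _, by simp, by simp [compressUpTo]⟩
  | succ k ih =>
    obtain ⟨M, hMF, hM, hle⟩ := ih (by omega)
    set R := compressUpTo k ℬ with hR
    have hroot : ∀ B ∈ ({B ∈ R | B.erase (k + 1) ∉ R} : Finset _), RootedAt R B (k + 1) := by
      intro B hB
      obtain ⟨hB, hBk⟩ := mem_filter.1 hB
      exact (h.simplyRooted_compressUpTo k).rootedAt_of_erase_notMem hB hBk
    refine ⟨M ∪ {B ∈ R | B.erase (k + 1) ∉ R}.image fun B => B.erase (k + 1), ?_, ?_, ?_⟩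
    · refine union_subset hMF fun C hC => ?_
      obtain ⟨B, hB, rfl⟩ := mem_image.1 hC
      exact hF B _ (by omega) hk (h.rootedAt_of_compressUpTo (Nat.lt_succ_self k)
        (hroot B hB) subset_rfl (mem_filter.1 hB).2)
    · intro C hC
      rcases mem_union.1 hC with hC | hC
      · exact mem_compression_of_forall_subset _ (hM C hC)
      · obtain ⟨B, hB, rfl⟩ := mem_image.1 hC
        exact fun X hX => (hroot B hB).mem_compression_self hX
    · rw [card_union_of_disjoint, card_image_of_injOn]
      · have := totalSize_le_totalSize_compression (k + 1) R
        change _ ≤ totalSize (𝓓 (k + 1) R) + _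
        omega
      · exact (erase_injOn' (k + 1)).mono fun B hB => (hroot B (mem_coe.1 hB)).1
      · rw [disjoint_left]
        intro C hC hC'
        obtain ⟨B, hB, rfl⟩ := mem_image.1 hC'
        exact (mem_filter.1 hB).2 (hM _ hC _ subset_rfl)

lemma SimplyRooted.totalSize_le_colexSum_add {ℬ F : Finset (Finset ℕ)} (h : SimplyRooted ℬ)
    {n : ℕ} (hn : ∀ B ∈ ℬ, B ⊆ Icc 1 n)
    (hF : ∀ B j, 1 ≤ j → j ≤ n → RootedAt ℬ B j → B.erase j ∈ F) :
    totalSize ℬ ≤ colexSum #ℬ + #F := by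
  obtain ⟨M, hMF, -, hle⟩ := h.exists_totalSize_le hF le_rfl
  have h₁ := card_le_card hMF
  have h₂ := edgeCount_le_colexSum (compressUpTo n ℬ)
  rw [← totalSize_eq_edgeCount (isDownSet_compressUpTo hn), card_compressUpTo] at h₂
  omega

lemma mem_rootedFam {ℬ : Finset (Finset ℕ)} {S B : Finset ℕ} :
    B ∈ rootedFam ℬ S ↔ B ∈ ℬ ∧ ∃ i ∈ S, RootedAt ℬ B i :=
  mem_filter

lemma RootedAt.rootedAt_rootedFam {ℬ : Finset (Finset ℕ)} {S B : Finset ℕ} {i : ℕ} (h : RootedAt ℬ B i)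
    (hi : i ∈ S) : RootedAt (rootedFam ℬ S) B i :=
  rootedAt_iff.2 ⟨h.1, fun _ hX hiX => mem_rootedFam.2 ⟨h.mem hX hiX, i, hi,
    rootedAt_iff.2 ⟨hiX, fun _ hYX hiY => h.mem (hYX.trans hX) hiY⟩⟩⟩

lemma SimplyRooted.card_filter_erase_notMem_le {ℬ : Finset (Finset ℕ)} (h : SimplyRooted ℬ)
    {B S T : Finset ℕ} (hB : B ∈ ℬ) (hST : Disjoint S T) (hBST : B ⊆ S ∪ T) :
    #{i ∈ B | B.erase i ∉ ℬ} + (if B ∈ rootedFam ℬ S ∩ rootedFam ℬ T then 1 else 0) ≤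
      if B ∈ rootedFam ℬ S ∪ rootedFam ℬ T then 1 else 0 := by
  rcases B.eq_empty_or_nonempty with rfl | hne
  · have : ∀ S, ∅ ∉ rootedFam ℬ S := by
      intro S hS
      obtain ⟨-, i, -, hi⟩ := mem_rootedFam.1 hS
      exact notMem_empty i hi.1
    simp [this]
  obtain ⟨b, hb⟩ := h.exists_rootedAt hB hne
  have hU : B ∈ rootedFam ℬ S ∪ rootedFam ℬ T := by
    rw [mem_union, mem_rootedFam, mem_rootedFam]
    rcases mem_union.1 (hBST hb.1) with hS | hT
    · exact Or.inl ⟨hB, b, hS, hb⟩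
    · exact Or.inr ⟨hB, b, hT, hb⟩
  rw [if_pos hU]
  split_ifs with hI
  · obtain ⟨hS, hT⟩ := mem_inter.1 hI
    obtain ⟨-, i, hi, hBi⟩ := mem_rootedFam.1 hS
    obtain ⟨-, j, hj, hBj⟩ := mem_rootedFam.1 hT
    have hij : i ≠ j := fun hij => disjoint_left.1 hST hi (hij ▸ hj)
    rw [filter_false_of_mem]
    · simp
    intro l _
    rw [not_not]
    by_cases hil : i = l
    · exact hBj.erase_mem (hil ▸ hij.symm)
    · exact hBi.erase_mem hil
  · rw [add_zero, card_le_one_iff_subset_singleton]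
    refine ⟨b, fun i hi => ?_⟩
    by_contra hib
    exact (mem_filter.1 hi).2 (hb.erase_mem fun hbi => hib (by simp [hbi]))

lemma SimplyRooted.totalSize_add_card_inter_le {ℬ : Finset (Finset ℕ)} (h : SimplyRooted ℬ)
    {S T : Finset ℕ} (hST : Disjoint S T) (hBST : ∀ B ∈ ℬ, B ⊆ S ∪ T) :
    totalSize ℬ + #(rootedFam ℬ S ∩ rootedFam ℬ T) ≤
      colexSum #ℬ + #(rootedFam ℬ S ∪ rootedFam ℬ T) := by
  have hsub : ∀ S, rootedFam ℬ S ⊆ ℬ := fun S => filter_subset _ _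
  have hsum := sum_le_sum fun B hB => h.card_filter_erase_notMem_le hB hST (hBST B hB)
  rw [sum_add_distrib, ← card_filter, ← card_filter, filter_mem_eq_inter, filter_mem_eq_inter,
    inter_eq_right.2 (inter_subset_left.trans (hsub S)),
    inter_eq_right.2 (union_subset (hsub S) (hsub T))] at hsum
  have htotal : totalSize ℬ = edgeCount ℬ + ∑ B ∈ ℬ, #{i ∈ B | B.erase i ∉ ℬ} := by
    unfold edgeCount
    rw [← sum_add_distrib]
    exact sum_congr rfl fun B _ => (card_filter_add_card_filter_not _).symm
  have := edgeCount_le_colexSum ℬ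
  omega

lemma SimplyRooted.two_mul_totalSize_le {ℬ : Finset (Finset ℕ)} (h : SimplyRooted ℬ) {n : ℕ}
    {S T : Finset ℕ} (hST : Disjoint S T) (hn : S ∪ T = Icc 1 n) (hB : ∀ B ∈ ℬ, B ⊆ Icc 1 n) :
    ∃ q, #(rootedFam ℬ S) * #(rootedFam ℬ T) ≤ 2 ^ n * q ∧
      2 * totalSize ℬ + q ≤ 2 * colexSum #ℬ + 2 * #(rootedFam ℬ S ∪ rootedFam ℬ T) := by
  set f := rootedFam ℬ S with hf
  set g := rootedFam ℬ T with hg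
  have hfB : ∀ A ∈ f, A ⊆ Icc 1 n := fun A hA => hB A (mem_rootedFam.1 hA).1
  have hgB : ∀ A ∈ g, A ⊆ Icc 1 n := fun A hA => hB A (mem_rootedFam.1 hA).1
  have lower : ∀ {R : Finset (Finset ℕ)}, IsDownSet R → IsLowerSet (R : Set (Finset ℕ)) :=
    fun hR A B hBA hA => hR A hA B hBA
  refine ⟨#(compressUpTo n f ∩ compressUpTo n g), ?_, ?_⟩
  · have := IsLowerSet.le_card_inter_finset' (lower (isDownSet_compressUpTo hfB))
      (lower (isDownSet_compressUpTo hgB)) (subset_of_mem_compressUpTo hfB n)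
      (subset_of_mem_compressUpTo hgB n)
    simpa [card_compressUpTo] using this
  · have h₁ := h.totalSize_add_card_inter_le hST (hn ▸ hB)
    have h₂ := h.totalSize_le_colexSum_add (F := compressUpTo n f ∪ compressUpTo n g) hB
      fun B j hj hjn hBj => by
        rcases mem_union.1 (hn ▸ mem_Icc.2 ⟨hj, hjn⟩ : j ∈ S ∪ T) with hS | hT
        · exact mem_union_left _ ((hBj.rootedAt_rootedFam hS).mem_compressUpTo hj hjn _ subset_rfl)
        · exact mem_union_right _ ((hBj.rootedAt_rootedFam hT).mem_compressUpTo hj hjn _ subset_rfl)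
    have h₃ := card_union_add_card_inter (compressUpTo n f) (compressUpTo n g)
    have h₄ := card_union_add_card_inter f g
    rw [card_compressUpTo, card_compressUpTo] at h₃
    rw [← hf, ← hg] at h₁
    omega

lemma SimplyRooted.card_le_card_union_rootedFam {ℬ : Finset (Finset ℕ)} (h : SimplyRooted ℬ)
    {S T : Finset ℕ} (hB : ∀ B ∈ ℬ, B ⊆ S ∪ T) :
    #(ℬ.erase ∅) ≤ #(rootedFam ℬ S ∪ rootedFam ℬ T) := by
  refine card_le_card fun B hB' => ?_
  obtain ⟨hne, hBm⟩ := mem_erase.1 hB'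
  obtain ⟨b, hb⟩ := h.exists_rootedAt hBm (nonempty_iff_ne_empty.2 hne)
  rw [mem_union, mem_rootedFam, mem_rootedFam]
  rcases mem_union.1 (hB B hBm hb.1) with hS | hT
  · exact Or.inl ⟨hBm, b, hS, hb⟩
  · exact Or.inr ⟨hBm, b, hT, hb⟩

lemma rootedFam_subset_erase_empty (ℬ : Finset (Finset ℕ)) (S : Finset ℕ) :
    rootedFam ℬ S ⊆ ℬ.erase ∅ := by
  intro B hB
  obtain ⟨hB, i, -, hi⟩ := mem_rootedFam.1 hB
  exact mem_erase.2 ⟨ne_empty_of_mem hi.1, hB⟩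

lemma card_rootedFam_Icc_succ_le (ℬ : Finset (Finset ℕ)) (k : ℕ) :
    #(rootedFam ℬ (Icc 1 (k + 1))) ≤ #(rootedFam ℬ (Icc 1 k)) + #(rootedFam ℬ {k + 1}) := by
  refine (card_le_card fun B hB => ?_).trans (card_union_le _ _)
  obtain ⟨hB, i, hi, hBi⟩ := mem_rootedFam.1 hB
  rw [mem_Icc] at hi
  rw [mem_union, mem_rootedFam, mem_rootedFam]
  rcases eq_or_ne i (k + 1) with rfl | hik
  · exact Or.inr ⟨hB, _, mem_singleton_self _, hBi⟩
  · exact Or.inl ⟨hB, i, mem_Icc.2 (by omega), hBi⟩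

/-- A sequence starting at `0` with increments at most `d` passes within `d / 2` of `M / 2`
on its way to `M`. -/
lemma exists_sq_sub_sq_div_four_le {φ : ℕ → ℝ} {d M : ℝ} {n : ℕ} (h₀ : φ 0 = 0) (hn : M ≤ φ n)
    (hd : 0 ≤ d) (hφ : ∀ k < n, φ (k + 1) ≤ φ k + d) (hM : 0 ≤ M) :
    ∃ k ≤ n, (M ^ 2 - d ^ 2) / 4 ≤ φ k * (M - φ k) := by
  by_cases hdM : M ≤ d
  · exact ⟨0, Nat.zero_le n, by rw [h₀]; nlinarith⟩
  have hex : ∃ k, (M - d) / 2 ≤ φ k := ⟨n, by linarith⟩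
  have hle : Nat.find hex ≤ n := Nat.find_min' hex (by linarith)
  refine ⟨Nat.find hex, hle, ?_⟩
  have hlow := Nat.find_spec hex
  have hup : φ (Nat.find hex) ≤ (M + d) / 2 := by
    cases hk : Nat.find hex with
    | zero => rw [h₀]; linarith
    | succ k =>
      have := Nat.find_min hex (m := k) (by omega)
      have := hφ k (by omega)
      linarith
  nlinarith

/-- If `ℬ ⊆ 𝒫(n)` is simply rooted with `|ℬ| = m`, `p ∈ [0,1]`
and `|ℬ_{{i}}| ≤ p·m` for all `i ∈ [n]`, then
`‖ℬ‖ ≤ ‖I(m)‖ + m - m²(1/12 - p²/12)/2^n`. -/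
theorem stmt6 (n : ℕ) (ℬ : Finset (Finset ℕ)) (hsub : ℬ ⊆ (Finset.Icc 1 n).powerset)
    (hsr : SimplyRooted ℬ) (m : ℕ) (hm : m = ℬ.card)
    (p : ℝ) (hp : p ∈ Set.Icc (0 : ℝ) 1)
    (hdeg : ∀ i ∈ Finset.Icc 1 n, ((rootedFam ℬ {i}).card : ℝ) ≤ p * m) :
    (totalSize ℬ : ℝ) ≤ (totalSize (colexInit m) : ℝ) + m
      - (m : ℝ) ^ 2 * (1 / 12 - p ^ 2 / 12) / 2 ^ n := by
  subst hm
  have hB : ∀ B ∈ ℬ, B ⊆ Icc 1 n := fun B hB => mem_powerset.1 (hsub hB)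
  have hmn : (#ℬ : ℝ) ≤ 2 ^ n := by
    have := card_le_card hsub
    rw [card_powerset, Nat.card_Icc, Nat.add_sub_cancel] at this
    exact_mod_cast this
  have hunion : ∀ k ≤ n, Icc 1 k ∪ Icc (k + 1) n = Icc 1 n := by
    intro k hk
    ext i
    simp only [mem_union, mem_Icc]
    omega
  have hcard : ∀ k ≤ n,
      #(rootedFam ℬ (Icc 1 k) ∪ rootedFam ℬ (Icc (k + 1) n)) = #(ℬ.erase ∅) := by
    intro k hk
    refine le_antisymm (card_le_card (union_subset ?_ ?_))
      (hsr.card_le_card_union_rootedFam (by rwa [hunion k hk])) <;>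
    exact rootedFam_subset_erase_empty _ _
  obtain ⟨k, hk, hkle⟩ := exists_sq_sub_sq_div_four_le (n := n)
    (φ := fun k => (#(rootedFam ℬ (Icc 1 k)) : ℝ)) (d := p * #ℬ) (M := #(ℬ.erase ∅))
    (by simp [rootedFam])
    (by
      have := hcard n le_rfl
      simp only [Icc_eq_empty_of_lt (Nat.lt_succ_self n)] at this
      rw [← this]
      simp [rootedFam])
    (mul_nonneg hp.1 (Nat.cast_nonneg _))
    (by
      intro k hk
      have h₁ : (#(rootedFam ℬ (Icc 1 (k + 1))) : ℝ) ≤ _ :=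
        Nat.cast_le.2 (card_rootedFam_Icc_succ_le ℬ k)
      push_cast at h₁
      exact h₁.trans (add_le_add_right (hdeg (k + 1) (mem_Icc.2 (by omega))) _))
    (Nat.cast_nonneg _)
  have hdisj : Disjoint (Icc 1 k) (Icc (k + 1) n) := by
    rw [disjoint_left]
    intro i
    simp only [mem_Icc]
    omega
  obtain ⟨q, hq, hle⟩ := hsr.two_mul_totalSize_le hdisj (hunion k hk) hB
  have hsum := card_union_le (rootedFam ℬ (Icc 1 k)) (rootedFam ℬ (Icc (k + 1) n))
  rw [hcard k hk] at hle hsum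
  have herase : #(ℬ.erase ∅) = #ℬ ∨ #(ℬ.erase ∅) + 1 = #ℬ := by
    by_cases hempty : ∅ ∈ ℬ
    · exact Or.inr (card_erase_add_one hempty)
    · exact Or.inl (by rw [erase_eq_of_notMem hempty])
  rw [totalSize_colexInit]
  generalize #(rootedFam ℬ (Icc 1 k)) = x at *
  generalize #(rootedFam ℬ (Icc (k + 1) n)) = y at *
  generalize #(ℬ.erase ∅) = r at *
  generalize #ℬ = m at *
  have hq' : (x : ℝ) * y ≤ 2 ^ n * q := by exact_mod_cast hq
  have hle' : 2 * (totalSize ℬ : ℝ) + q ≤ 2 * colexSum m + 2 * r := by exact_mod_cast hle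
  have hsum' : (r : ℝ) ≤ x + y := by exact_mod_cast hsum
  have hN : (0 : ℝ) < 2 ^ n := by positivity
  generalize (2 : ℝ) ^ n = N at *
  have hx : (0 : ℝ) ≤ x := Nat.cast_nonneg x
  have hm₀ : (0 : ℝ) ≤ m := Nat.cast_nonneg m
  have hxy : ((r : ℝ) ^ 2 - (p * m) ^ 2) / 4 ≤ N * q :=
    hkle.trans ((mul_le_mul_of_nonneg_left (by linarith) hx).trans hq')
  have hqpos : (0 : ℝ) ≤ q := Nat.cast_nonneg q
  have hpsq : 0 ≤ 1 - p ^ 2 := by nlinarith [hp.1, hp.2]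
  have key : (m : ℝ) ^ 2 * (1 / 12 - p ^ 2 / 12) / N ≤ q / 2 + (m - r) := by
    rw [div_le_iff₀ hN]
    rcases herase with rfl | herase
    · nlinarith [mul_nonneg (sq_nonneg (r : ℝ)) hpsq]
    · have hr : (r : ℝ) = m - 1 := by rw [← herase]; push_cast; ring
      rw [hr] at hxy ⊢
      nlinarith [mul_nonneg (sq_nonneg (m : ℝ)) hpsq]
  linarith
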